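/- arXiv:math/9908168 — 5 statements merged into one kernel-verified Lean document; each statement's English description precedes it below -/
import Mathlib

section
/- Let X be a compact Hausdorff space of covering dimension at most 2 and let p : E → X be a locally trivial continuous complex vector bundle over X of rank m ≥ 2. Then E admits a continuous nowhere-vanishing section. -/
open Metric Set

noncomputable section

/-- The covering dimension of a topological space is at most `n`: every finite open cover
admits a finite open refinement in which every point belongs to at most `n + 1` of the
refining sets. -/
def covDimLE (X : Type*) [TopologicalSpace X] (n : ℕ) : Prop :=
  ∀ U : Finset (Set X), (∀ u ∈ U, IsOpen u) → ⋃₀ (U : Set (Set X)) = Set.univ →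
    ∃ V : Finset (Set X), (∀ v ∈ V, IsOpen v) ∧ ⋃₀ (V : Set (Set X)) = Set.univ ∧
      (∀ v ∈ V, ∃ u ∈ U, v ⊆ u) ∧
      ∀ x : X, Set.ncard {v : Set X | v ∈ V ∧ x ∈ v} ≤ n + 1

/-- The covering dimension of a topological space equals `n`: `n` is the least natural
number `m` such that `covDimLE X m` holds. -/
def covDimEq (X : Type*) [TopologicalSpace X] (n : ℕ) : Prop :=
  covDimLE X n ∧ ∀ m : ℕ, covDimLE X m → n ≤ m

open MeasureTheory in
/-- Finitely many points of a finite-dimensional real normed space can be moved by arbitrarily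
little so that any `n` of them are linearly independent, where `n` is at most the dimension. -/
theorem exists_dist_lt_forall_linearIndepOn {F ι : Type*} [NormedAddCommGroup F]
    [NormedSpace ℝ F] [FiniteDimensional ℝ F] {n : ℕ} (hn : n ≤ Module.finrank ℝ F)
    (q : ι → F) {ε : ℝ} (hε : 0 < ε) (T : Finset ι) :
    ∃ p : ι → F, (∀ i, dist (p i) (q i) < ε) ∧
      ∀ S ⊆ T, S.card ≤ n → LinearIndepOn ℝ p (S : Set ι) := by
  classical
  induction T using Finset.induction_on with
  | empty =>
    refine ⟨q, fun i => by simpa using hε, fun S hS _ => ?_⟩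
    rw [Finset.subset_empty.1 hS, Finset.coe_empty]
    exact linearIndepOn_empty ℝ q
  | insert a T ha ih =>
    obtain ⟨p, hpq, hp⟩ := ih
    let _ : MeasurableSpace F := borel F
    have : BorelSpace F := ⟨rfl⟩
    let B : Set F := ⋃ S ∈ T.powerset.filter (fun S => S.card < n),
      (Submodule.span ℝ (p '' (S : Set ι)) : Set F)
    have hB : (Measure.addHaar : Measure F) B = 0 := by
      refine (measure_biUnion_null_iff (Finset.countable_toSet _)).2 fun S hS => ?_
      refine Measure.addHaar_submodule _ _ fun htop => ?_
      have hcard : S.card < n := (Finset.mem_filter.1 hS).2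
      have h := finrank_span_finset_le_card (R := ℝ) (S.image p)
      rw [Set.finrank, Finset.coe_image, htop, finrank_top] at h
      have := S.card_image_le (f := p)
      omega
    obtain ⟨y, hy, hyB⟩ : ∃ y ∈ ball (q a) ε, y ∉ B := by
      by_contra! h
      exact (measure_ball_pos (Measure.addHaar : Measure F) (q a) hε).ne'
        (measure_mono_null h hB)
    refine ⟨Function.update p a y, fun i => ?_, fun S hS hcard => ?_⟩
    · rcases eq_or_ne i a with rfl | hi
      · simpa using hy
      · simpa [hi] using hpq i
    · have hcongr : ∀ S' ⊆ T, Set.EqOn p (Function.update p a y) (S' : Set ι) := by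
        intro S' hS' i hi
        rw [Function.update_of_ne]
        rintro rfl
        exact ha (hS' hi)
      by_cases haS : a ∈ S
      · have hsub : S.erase a ⊆ T := Finset.subset_insert_iff.1 hS
        have hlt : (S.erase a).card < S.card := Finset.card_erase_lt_of_mem haS
        rw [← Finset.insert_erase haS, Finset.coe_insert]
        refine ((hp _ hsub (by omega)).congr (hcongr _ hsub)).insert ?_
        rw [← (hcongr _ hsub).image_eq, Function.update_self]
        intro hmem
        refine hyB (Set.mem_biUnion (x := S.erase a) ?_ hmem)
        simp only [Finset.coe_filter, Finset.mem_powerset, Set.mem_ofPred_eq]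
        exact ⟨hsub, by omega⟩
      · have hsub : S ⊆ T := (Finset.subset_insert_iff_of_notMem haS).1 hS
        exact (hp S hsub hcard).congr (hcongr S hsub)

/-- A continuous map from a compact Hausdorff space to a real vector space of larger dimension
can be approximated by nowhere-vanishing continuous maps. -/
theorem covDimLE.exists_dist_lt_forall_ne_zero {X F : Type*} [TopologicalSpace X] [CompactSpace X]
    [T2Space X] [NormedAddCommGroup F] [NormedSpace ℝ F] [FiniteDimensional ℝ F] {n : ℕ}
    (hX : covDimLE X n) (hn : n < Module.finrank ℝ F) (f : C(X, F)) {ε : ℝ} (hε : 0 < ε) :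
    ∃ g : C(X, F), (∀ x, dist (g x) (f x) < ε) ∧ ∀ x, g x ≠ 0 := by
  classical
  have hε2 : 0 < ε / 2 := by positivity
  obtain ⟨c, hcfin, hc⟩ :=
    Metric.totallyBounded_iff.1 (isCompact_range f.continuous).totallyBounded (ε / 2) hε2
  obtain ⟨V, hVo, hVc, hVU, hVn⟩ := hX (hcfin.toFinset.image fun y => f ⁻¹' ball y (ε / 2))
    (by
      intro u hu
      obtain ⟨y, -, rfl⟩ := Finset.mem_image.1 hu
      exact isOpen_ball.preimage f.continuous)
    (by
      refine eq_univ_of_forall fun x => ?_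
      obtain ⟨y, hy, hxy⟩ := mem_iUnion₂.1 (hc (mem_range_self x))
      exact ⟨_, Finset.mem_coe.2 (Finset.mem_image_of_mem _ (hcfin.mem_toFinset.2 hy)), hxy⟩)
  have hq : ∀ v : V, ∃ y, (v : Set X) ⊆ f ⁻¹' ball y (ε / 2) := by
    intro v
    obtain ⟨u, hu, hvu⟩ := hVU v v.2
    obtain ⟨y, -, rfl⟩ := Finset.mem_image.1 hu
    exact ⟨y, hvu⟩
  choose q hq using hq
  obtain ⟨p, hpq, hp⟩ :=
    exists_dist_lt_forall_linearIndepOn (Nat.succ_le_of_lt hn) q hε2 Finset.univ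
  obtain ⟨ρ, hρ⟩ := PartitionOfUnity.exists_isSubordinate_of_locallyFinite isClosed_univ
    (fun v : V => (v : Set X)) (fun v => hVo v v.2) (locallyFinite_of_finite _)
    (by rw [← hVc, sUnion_eq_iUnion]; rfl)
  have hmem : ∀ x v, ρ v x ≠ 0 → x ∈ (v : Set X) := fun x v h => hρ v (subset_tsupport _ h)
  refine ⟨⟨fun x => ∑ᶠ v, ρ v x • p v,
    ρ.continuous_finsum_smul fun _ _ _ => continuousAt_const⟩, fun x => ?_, fun x h0 => ?_⟩
  · refine ρ.finsum_smul_mem_convex (g := fun v _ => p v) (mem_univ x) (fun v hv => ?_)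
      (convex_ball (f x) ε)
    have h1 : dist (f x) (q v) < ε / 2 := hq v (hmem x v hv)
    have h2 := dist_triangle_right (p v) (f x) (q v)
    have h3 := hpq v
    exact mem_ball.2 (by linarith)
  · have hsum : ∑ v ∈ ρ.finsupport x, ρ v x • p v = 0 :=
      (ρ.sum_finsupport_smul_eq_finsum fun v _ => p v).trans h0
    have hcard : (ρ.finsupport x).card ≤ n + 1 := by
      refine le_trans ?_ (hVn x)
      rw [← Finset.card_map (Function.Embedding.subtype _), ← Set.ncard_coe_finset]
      refine Set.ncard_le_ncard ?_ (V.finite_toSet.subset fun v hv => hv.1)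
      intro v hv
      obtain ⟨w, hw, rfl⟩ := Finset.mem_map.1 (Finset.mem_coe.1 hv)
      exact ⟨w.2, hmem x w ((ρ.mem_finsupport x).1 hw)⟩
    have hzero := linearIndepOn_finset_iff.1 (hp _ (Finset.subset_univ _) hcard) _ hsum
    have hone := ρ.sum_finsupport (mem_univ x)
    rw [Finset.sum_eq_zero hzero] at hone
    exact zero_ne_one hone

section VectorBundle

variable {X F : Type*} [TopologicalSpace X] [CompactSpace X] [T2Space X]
  [NormedAddCommGroup F] [NormedSpace ℂ F] {E : X → Type*} [∀ x, AddCommGroup (E x)]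
  [∀ x, Module ℂ (E x)] [∀ x, TopologicalSpace (E x)] [TopologicalSpace (Bundle.TotalSpace F E)]
  [FiberBundle F E] [VectorBundle ℂ F E]

open Topology Bundle in
/-- Near any point, a section of a vector bundle can be perturbed to a nowhere-vanishing one while
keeping it nonzero on a given closed set. -/
theorem exists_mem_nhds_exists_section_ne_zero
    (H : ∀ (f : C(X, F)) (ε : ℝ), 0 < ε →
      ∃ g : C(X, F), (∀ x, dist (g x) (f x) < ε) ∧ ∀ x, g x ≠ 0) (x₀ : X) :
    ∃ K ∈ 𝓝 x₀, IsClosed K ∧ ∀ (s : (x : X) → E x) (C : Set X), IsClosed C →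
      Continuous (fun x => TotalSpace.mk' F x (s x)) → (∀ x ∈ C, s x ≠ 0) →
      ∃ s' : (x : X) → E x, Continuous (fun x => TotalSpace.mk' F x (s' x)) ∧
        ∀ x ∈ C ∪ K, s' x ≠ 0 := by
  let e := trivializationAt F E x₀
  have hU : IsOpen e.baseSet := e.open_baseSet
  obtain ⟨K, hK, hKc, hKU⟩ :=
    exists_mem_nhds_isClosed_subset (hU.mem_nhds (FiberBundle.mem_baseSet_trivializationAt' x₀))
  obtain ⟨φ, hφK, hφc, hφU, hφI⟩ :=
    exists_continuousMap_one_of_isCompact_subset_isOpen hKc.isCompact hU hKU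
  obtain ⟨ψ, hψφ, hψc, hψU, -⟩ :=
    exists_continuousMap_one_of_isCompact_subset_isOpen hφc hU hφU
  refine ⟨K, hK, hKc, fun s C hC hs hsC => ?_⟩
  have hcoord : ∀ x ∈ e.baseSet, ContinuousAt (fun y => (e ⟨y, s y⟩).2) x := fun x hx =>
    ((e.tendsto_nhds_iff (e.mem_source.2 hx)).1 hs.continuousAt).2
  let f : C(X, F) :=
    { toFun := fun x => (ψ x : ℂ) • (e ⟨x, s x⟩).2
      continuous_toFun := by
        refine continuous_iff_continuousAt.2 fun x => ?_
        by_cases hx : x ∈ e.baseSet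
        · exact (Complex.continuous_ofReal.comp ψ.continuous).continuousAt.smul (hcoord x hx)
        · refine (continuousAt_const (y := (0 : F))).congr ?_
          have := (isClosed_tsupport ψ).isOpen_compl.mem_nhds fun h => hx (hψU h)
          filter_upwards [this] with y hy
          simp [image_eq_zero_of_notMem_tsupport hy] }
  have hf : ∀ x ∈ tsupport φ, f x = e.linearMapAt ℂ x (s x) := by
    intro x hx
    have h1 : ψ x = 1 := hψφ hx
    rw [e.coe_linearMapAt_of_mem (R := ℂ) (hφU hx)]
    simp [f, h1]
  obtain ⟨δ, hδ, hδf⟩ : ∃ δ > 0, ∀ x ∈ C ∩ tsupport φ, δ ≤ ‖f x‖ := by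
    rcases (C ∩ tsupport φ).eq_empty_or_nonempty with h | h
    · exact ⟨1, one_pos, by simp [h]⟩
    · obtain ⟨x, hx, hmin⟩ := (hC.inter (isClosed_tsupport φ)).isCompact.exists_isMinOn h
        f.continuous.norm.continuousOn
      refine ⟨‖f x‖, norm_pos_iff.2 fun h0 => hsC x hx.1 ?_, hmin⟩
      rw [hf x hx.2] at h0
      simpa [h0] using (e.symmₗ_linearMapAt (R := ℂ) (hφU hx.2) (s x)).symm
  obtain ⟨g, hgf, hg⟩ := H f δ hδ
  let s' : (x : X) → E x := fun x => s x + e.symmₗ ℂ x ((φ x : ℂ) • (g x - f x))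
  have hs'_off : ∀ x ∉ tsupport φ, s' x = s x := fun x hx => by
    simp [s', image_eq_zero_of_notMem_tsupport hx]
  have hs'_coord : ∀ x ∈ e.baseSet,
      e.linearMapAt ℂ x (s' x) = e.linearMapAt ℂ x (s x) + (φ x : ℂ) • (g x - f x) := by
    intro x hx
    simp only [s', map_add]
    rw [e.linearMapAt_symmₗ hx]
  refine ⟨s', continuous_iff_continuousAt.2 fun x => ?_, fun x hx h0 => ?_⟩
  · by_cases hx : x ∈ e.baseSet
    · refine (e.tendsto_nhds_iff (e.mem_source.2 hx)).2 ⟨continuousAt_id, ?_⟩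
      have hφ : Continuous fun y => (φ y : ℂ) • (g y - f y) :=
        (Complex.continuous_ofReal.comp φ.continuous).smul (g.continuous.sub f.continuous)
      refine ((hcoord x hx).add hφ.continuousAt).congr ?_
      filter_upwards [hU.mem_nhds hx] with y hy
      have h := (hs'_coord y hy).symm
      rw [e.coe_linearMapAt_of_mem hy] at h
      exact h
    · refine hs.continuousAt.congr ?_
      have := (isClosed_tsupport φ).isOpen_compl.mem_nhds fun h => hx (hφU h)
      filter_upwards [this] with y hy
      rw [hs'_off y hy]
  · by_cases hxφ : x ∈ tsupport φ
    · have h1 := hs'_coord x (hφU hxφ)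
      rw [h0, map_zero, ← hf x hxφ] at h1
      rcases hx with hx | hx
      · have h2 : f x = -((φ x : ℂ) • (g x - f x)) := eq_neg_of_add_eq_zero_left h1.symm
        have h3 : ‖f x‖ ≤ dist (g x) (f x) := by
          rw [h2, norm_neg, norm_smul, dist_eq_norm, ← h2, Complex.norm_real,
            Real.norm_of_nonneg (hφI x).1]
          exact mul_le_of_le_one_left (norm_nonneg _) (hφI x).2
        exact absurd (hδf x ⟨hx, hxφ⟩) (not_le.2 (h3.trans_lt (hgf x)))
      · have h2 : φ x = 1 := hφK hx
        rw [h2] at h1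
        exact hg x (by simpa using h1.symm)
    · rw [hs'_off x hxφ] at h0
      rcases hx with hx | hx
      · exact hsC x hx h0
      · refine hxφ (subset_tsupport _ ?_)
        have h2 : φ x = 1 := hφK hx
        simp [h2]

open Topology Bundle in
/-- If maps from the base to the model fiber can be approximated by nowhere-vanishing ones, then
a vector bundle over a compact Hausdorff space has a nowhere-vanishing section. -/
theorem exists_section_ne_zero_of_approx
    (H : ∀ (f : C(X, F)) (ε : ℝ), 0 < ε →
      ∃ g : C(X, F), (∀ x, dist (g x) (f x) < ε) ∧ ∀ x, g x ≠ 0) :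
    ∃ s : (x : X) → E x, Continuous (fun x => TotalSpace.mk' F x (s x)) ∧ ∀ x, s x ≠ 0 := by
  obtain ⟨K, hK, -, h⟩ : ∃ K : Set X, univ ⊆ K ∧ IsClosed K ∧
      ∀ (s : (x : X) → E x) (C : Set X), IsClosed C →
        Continuous (fun x => TotalSpace.mk' F x (s x)) → (∀ x ∈ C, s x ≠ 0) →
        ∃ s' : (x : X) → E x, Continuous (fun x => TotalSpace.mk' F x (s' x)) ∧
          ∀ x ∈ C ∪ K, s' x ≠ 0 := by
    refine isCompact_univ.induction_on ?_ ?_ ?_ ?_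
    · exact ⟨∅, Subset.rfl, isClosed_empty, fun s C _ hs hsC => ⟨s, hs, by simpa using hsC⟩⟩
    · rintro A B hAB ⟨K, hBK, hK⟩
      exact ⟨K, hAB.trans hBK, hK⟩
    · rintro A B ⟨K, hAK, hK, hK'⟩ ⟨L, hBL, hL, hL'⟩
      refine ⟨K ∪ L, union_subset_union hAK hBL, hK.union hL, fun s C hC hs hsC => ?_⟩
      obtain ⟨s₁, hs₁, hsC₁⟩ := hK' s C hC hs hsC
      obtain ⟨s₂, hs₂, hsC₂⟩ := hL' s₁ (C ∪ K) (hC.union hK) hs₁ hsC₁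
      exact ⟨s₂, hs₂, by rwa [← union_assoc]⟩
    · intro x _
      obtain ⟨K, hKx, hK, hK'⟩ := exists_mem_nhds_exists_section_ne_zero (E := E) H x
      exact ⟨K, mem_nhdsWithin_of_mem_nhds hKx, K, Subset.rfl, hK, hK'⟩
  obtain ⟨s, hs, hs0⟩ :=
    h (fun _ => 0) ∅ isClosed_empty (Trivialization.continuous_zeroSection ℂ) (by simp)
  exact ⟨s, hs, fun x => hs0 x (Or.inr (hK (mem_univ x)))⟩

end VectorBundle

/-- **Nowhere-vanishing sections of vector bundles over 2-dimensional compacta**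
(Lemma 3.2 of the paper). Let `X` be a compact Hausdorff space of covering dimension at
most `2` and let `E` be a locally trivial continuous complex vector bundle over `X` of
rank `m ≥ 2`. Then `E` admits a continuous nowhere-vanishing section. -/
theorem exists_nowhere_vanishing_section
    (X : Type) [TopologicalSpace X] [CompactSpace X] [T2Space X]
    (hdim : covDimLE X 2) (m : ℕ) (hm : 2 ≤ m)
    (E : X → Type) [∀ x, AddCommGroup (E x)] [∀ x, Module ℂ (E x)]
    [∀ x, TopologicalSpace (E x)]
    [TopologicalSpace (Bundle.TotalSpace (Fin m → ℂ) E)]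
    [FiberBundle (Fin m → ℂ) E] [VectorBundle ℂ (Fin m → ℂ) E] :
    ∃ s : (x : X) → E x,
      Continuous (fun x => (Bundle.TotalSpace.mk x (s x) : Bundle.TotalSpace (Fin m → ℂ) E)) ∧
      ∀ x, s x ≠ 0 := by
  refine exists_section_ne_zero_of_approx fun f ε hε => hdim.exists_dist_lt_forall_ne_zero ?_ f hε
  rw [finrank_real_of_complex, Module.finrank_fin_fun]
  omega

end
end

section
/- Let G be a discrete group and let g ∈ G be an element of infinite order. Then for every ξ ∈ βG one has ξg ≠ ξ and gξ ≠ ξ, where ξ ↦ ξg and ξ ↦ gξ denote the unique continuous extensions to βG of right and left translation by g on G. -/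
open Metric Set

noncomputable section

/-- A permutation all of whose cycles are infinite admits a two-colouring that it flips. -/
theorem Equiv.Perm.exists_bool_coloring {X : Type*} (f : Equiv.Perm X)
    (hf : ∀ (n : ℤ) (x : X), (f ^ n) x = x → n = 0) :
    ∃ c : X → Bool, ∀ x, c (f x) = !c x := by
  let rep : X → X := fun x => (Quotient.mk (Equiv.Perm.SameCycle.setoid f) x).out
  have rep_sameCycle (x : X) : f.SameCycle (rep x) x :=
    Quotient.exact (s := Equiv.Perm.SameCycle.setoid f) (Quotient.out_eq _)
  have rep_apply (x : X) : rep (f x) = rep x := by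
    have h : Quotient.mk (Equiv.Perm.SameCycle.setoid f) (f x) = Quotient.mk _ x :=
      Quotient.sound (s := Equiv.Perm.SameCycle.setoid f) ⟨-1, by simp⟩
    simp only [rep, h]
  choose n hn using rep_sameCycle
  have n_apply (x : X) : n (f x) = n x + 1 := by
    have h : (f ^ n (f x)) (rep x) = (f ^ (n x + 1)) (rep x) := by
      rw [add_comm, zpow_add, Equiv.Perm.mul_apply, hn x, zpow_one, ← rep_apply x, hn]
    have h0 : (f ^ (-(n x + 1) + n (f x))) (rep x) = rep x := by
      rw [zpow_add, Equiv.Perm.mul_apply, h, ← Equiv.Perm.mul_apply, ← zpow_add]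
      simp
    have := hf _ _ h0
    omega
  refine ⟨fun x => decide (Even (n x)), fun x => ?_⟩
  simp only [n_apply, Int.even_add_one, decide_not]

/-- The Stone–Čech extension of a permutation with only infinite cycles has no fixed point. -/
theorem stoneCech_extension_ne_self {X : Type*} [TopologicalSpace X] [DiscreteTopology X]
    (f : Equiv.Perm X) (hf : ∀ (n : ℤ) (x : X), (f ^ n) x = x → n = 0)
    (F : StoneCech X → StoneCech X) (hF : Continuous F)
    (hFf : ∀ x, F (stoneCechUnit x) = stoneCechUnit (f x)) (ξ : StoneCech X) : F ξ ≠ ξ := by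
  obtain ⟨c, hc⟩ := f.exists_bool_coloring hf
  have hcont : Continuous c := continuous_of_discreteTopology
  have hE : Continuous (stoneCechExtend hcont) := continuous_stoneCechExtend hcont
  have h : stoneCechExtend hcont ∘ F = (fun b => !b) ∘ stoneCechExtend hcont := by
    refine stoneCech_hom_ext (hE.comp hF) (continuous_of_discreteTopology.comp hE) ?_
    funext x
    simp [hFf, hc, stoneCechExtend_stoneCechUnit]
  intro hξ
  have := congrFun h ξ
  simp [hξ] at this

/-- **Fixed-point freeness of translations on `βG`** (Lemma 5.2 of the paper, for elements
of infinite order). Let `G` be a discrete group and let `g ∈ G` have infinite order. Then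
for every `ξ ∈ βG` one has `ξg ≠ ξ` and `gξ ≠ ξ`, where `ξ ↦ ξg` and `ξ ↦ gξ` denote the
(unique) continuous extensions to `βG` of right and left translation by `g`. -/
theorem stoneCech_translation_no_fixed_point
    (G : Type) [Group G] [TopologicalSpace G] [DiscreteTopology G]
    (g : G) (hg : ¬ IsOfFinOrder g) (ξ : StoneCech G) :
    (∀ R : StoneCech G → StoneCech G, Continuous R →
      (∀ x : G, R (stoneCechUnit x) = stoneCechUnit (x * g)) → R ξ ≠ ξ) ∧
    (∀ L : StoneCech G → StoneCech G, Continuous L →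
      (∀ x : G, L (stoneCechUnit x) = stoneCechUnit (g * x)) → L ξ ≠ ξ) := by
  have hpow (n : ℤ) (h : g ^ n = 1) : n = 0 := by
    by_contra hn
    exact hg (isOfFinOrder_iff_zpow_eq_one.mpr ⟨n, hn, h⟩)
  refine ⟨fun R hR hRg => ?_, fun L hL hLg => ?_⟩
  · refine stoneCech_extension_ne_self (Equiv.mulRight g) (fun n x h => hpow n ?_) R hR hRg ξ
    simpa using h
  · refine stoneCech_extension_ne_self (Equiv.mulLeft g) (fun n x h => hpow n ?_) L hL hLg ξ
    simpa using h

end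
end

section
/- Let G be a free group on a nonempty finite or countably infinite set of generators. For ξ ∈ βG set P(ξ) = {ξg : g ∈ G}, the orbit of ξ under the extended right action of G on βG. If ξ₁, ξ₂ ∈ βG are such that the closures of P(ξ₁) and P(ξ₂) in βG have nonempty intersection, then one of these two closures contains the other. -/
open Metric Set

noncomputable section

/-- The continuous extension to `βG` of right translation by `g` on a discrete group `G`:
`ξ ↦ ξg`. -/
def rightTrans {G : Type} [Group G] [TopologicalSpace G] [DiscreteTopology G] (g : G) :
    StoneCech G → StoneCech G :=
  stoneCechExtend (continuous_of_discreteTopology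
    (f := fun x : G => stoneCechUnit (x * g)))

theorem continuous_rightTrans {G : Type} [Group G] [TopologicalSpace G] [DiscreteTopology G]
    (g : G) : Continuous (rightTrans g) :=
  continuous_stoneCechExtend _

theorem rightTrans_stoneCechUnit {G : Type} [Group G] [TopologicalSpace G] [DiscreteTopology G]
    (g x : G) : rightTrans g (stoneCechUnit x) = stoneCechUnit (x * g) :=
  stoneCechExtend_stoneCechUnit _ x

theorem rightTrans_rightTrans {G : Type} [Group G] [TopologicalSpace G] [DiscreteTopology G]
    (g k : G) (ξ : StoneCech G) : rightTrans k (rightTrans g ξ) = rightTrans (g * k) ξ := by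
  refine congrFun (denseRange_stoneCechUnit.equalizer
    ((continuous_rightTrans k).comp (continuous_rightTrans g))
    (continuous_rightTrans (g * k)) ?_) ξ
  funext x
  simp [rightTrans_stoneCechUnit, mul_assoc]

theorem rightTrans_mem_closure_orbit {G : Type} [Group G] [TopologicalSpace G]
    [DiscreteTopology G] {ξ η : StoneCech G}
    (h : η ∈ closure (Set.range fun g : G => rightTrans g ξ)) (k : G) :
    rightTrans k η ∈ closure (Set.range fun g : G => rightTrans g ξ) := by
  refine map_mem_closure (continuous_rightTrans k) h ?_
  rintro _ ⟨g, rfl⟩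
  exact ⟨g * k, (rightTrans_rightTrans g k ξ).symm⟩

theorem closure_orbit_subset {G : Type} [Group G] [TopologicalSpace G]
    [DiscreteTopology G] {ξ η : StoneCech G} (g : G)
    (h : rightTrans g η ∈ closure (Set.range fun g : G => rightTrans g ξ)) :
    closure (Set.range fun g : G => rightTrans g η) ⊆
      closure (Set.range fun g : G => rightTrans g ξ) := by
  refine closure_minimal ?_ isClosed_closure
  rintro _ ⟨k, rfl⟩
  have := rightTrans_mem_closure_orbit h (g⁻¹ * k)
  rwa [rightTrans_rightTrans, mul_inv_cancel_left] at this

/-- A countable set disjoint from the closure of `t` can be covered by countably many open sets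
whose closures miss `t`. -/
theorem Set.Countable.hasSeparatingCover {X : Type*} [TopologicalSpace X] [RegularSpace X]
    {s t : Set X} (hs : s.Countable) (h : Disjoint s (closure t)) : HasSeparatingCover s t := by
  rcases s.eq_empty_or_nonempty with rfl | hne
  · exact ⟨fun _ => ∅, by simp, by simp⟩
  obtain ⟨f, rfl⟩ := hs.exists_eq_range hne
  have key (n : ℕ) : ∃ u : Set X, f n ∈ u ∧ IsOpen u ∧ Disjoint (closure u) t := by
    have hn : (closure t)ᶜ ∈ nhds (f n) :=
      isClosed_closure.isOpen_compl.mem_nhds (Set.disjoint_left.1 h ⟨n, rfl⟩)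
    obtain ⟨c, hc, hcc, hct⟩ := exists_mem_nhds_isClosed_subset hn
    refine ⟨interior c, mem_interior_iff_mem_nhds.2 hc, isOpen_interior, ?_⟩
    exact (Set.disjoint_left.2 fun x hx hxt =>
      hct (closure_minimal interior_subset hcc hx) (subset_closure hxt))
  choose u hfu huo hut using key
  refine ⟨u, ?_, fun n => ⟨huo n, hut n⟩⟩
  rintro _ ⟨n, rfl⟩
  exact Set.mem_iUnion.2 ⟨n, hfu n⟩

/-- In a regular extremally disconnected space, two countable sets, each disjoint from the closure
of the other, have disjoint closures. -/
theorem ExtremallyDisconnected.disjoint_closure_of_countable {X : Type*} [TopologicalSpace X]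
    [RegularSpace X] [ExtremallyDisconnected X] {s t : Set X} (hs : s.Countable)
    (ht : t.Countable) (hst : Disjoint s (closure t)) (hts : Disjoint t (closure s)) :
    Disjoint (closure s) (closure t) := by
  obtain ⟨u, v, hu, hv, hsu, htv, huv⟩ := hasSeparatingCovers_iff_separatedNhds.1
    ⟨hs.hasSeparatingCover hst, ht.hasSeparatingCover hts⟩
  exact (ExtremallyDisconnected.disjoint_closure_of_disjoint_isOpen huv hu hv).mono
    (closure_mono hsu) (closure_mono htv)

/-- **Nested orbit closures in `βG` for free groups** (Corollary 2.5 of the paper).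
Let `G` be a free group on a nonempty finite or countably infinite set of generators,
regarded as a discrete group, and for `ξ ∈ βG` let `P(ξ) = {ξg : g ∈ G}` be its orbit
under the extended right action of `G` on `βG`. If the closures of `P(ξ₁)` and `P(ξ₂)`
intersect, then one of them contains the other. -/
theorem freeGroup_orbit_closures_nested (α : Type) [Nonempty α] [Countable α]
    [TopologicalSpace (FreeGroup α)] [DiscreteTopology (FreeGroup α)]
    (ξ₁ ξ₂ : StoneCech (FreeGroup α))
    (h : (closure (Set.range fun g : FreeGroup α => rightTrans g ξ₁) ∩
          closure (Set.range fun g : FreeGroup α => rightTrans g ξ₂)).Nonempty) :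
    closure (Set.range fun g : FreeGroup α => rightTrans g ξ₁) ⊆
      closure (Set.range fun g : FreeGroup α => rightTrans g ξ₂) ∨
    closure (Set.range fun g : FreeGroup α => rightTrans g ξ₂) ⊆
      closure (Set.range fun g : FreeGroup α => rightTrans g ξ₁) := by
  have : Countable (FreeGroup α) := Quot.mk_surjective.countable
  have : ExtremallyDisconnected (StoneCech (FreeGroup α)) :=
    StoneCech.projective.extremallyDisconnected
  by_contra! hn
  obtain ⟨h₁, h₂⟩ := hn
  refine Set.not_disjoint_iff_nonempty_inter.2 h
    (ExtremallyDisconnected.disjoint_closure_of_countable (Set.countable_range _)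
      (Set.countable_range _) ?_ ?_)
  · rw [Set.disjoint_left]
    rintro _ ⟨g, rfl⟩ hg
    exact h₁ (closure_orbit_subset g hg)
  · rw [Set.disjoint_left]
    rintro _ ⟨g, rfl⟩ hg
    exact h₂ (closure_orbit_subset g hg)

end
end

section
/- Let G be a countably infinite discrete group. Then there exists ξ ∈ βG ∖ G such that ξ belongs to the closure of the punctured orbit {ξg : g ∈ G, g ≠ e} under the extended right action; consequently the orbit map g ↦ ξg is not a homeomorphism of the discrete space G onto its image in βG. -/
open Metric Set

noncomputable section

/-- An infinite group carries a nonprincipal ultrafilter which is idempotent for the convolution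
`(U, V) ↦ {s | ∀ᶠ g in U, ∀ᶠ x in V, x * g ∈ s}`. -/
theorem exists_nonprincipal_idempotent_ultrafilter (G : Type*) [Group G] [Infinite G] :
    ∃ p : Ultrafilter G, (p : Filter G) ≤ Filter.cofinite ∧
      ∀ P : G → Prop, (∀ᶠ x in p, P x) ↔ ∀ᶠ g in p, ∀ᶠ x in p, P (x * g) := by
  let : Semigroup (Ultrafilter G) := Ultrafilter.semigroup
  have mem_iff (U : Ultrafilter G) :
      (U : Filter G) ≤ Filter.cofinite ↔ ∀ a, ∀ᶠ x in (U : Filter G), x ≠ a :=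
    Filter.le_cofinite_iff_eventually_ne
  obtain ⟨p, hp, hpp⟩ := exists_idempotent_in_compact_subsemigroup
    (M := Ultrafilter G) Ultrafilter.continuous_mul_left
    {U | (U : Filter G) ≤ Filter.cofinite}
    ⟨Filter.hyperfilter G, Filter.hyperfilter_le_cofinite⟩
    (by
      simp only [mem_iff, Set.ofPred_forall]
      exact (isClosed_iInter fun a => ultrafilter_isClosed_basic {x | x ≠ a}).isCompact)
    (by
      simp only [Set.mem_ofPred_eq, mem_iff]
      intro U _ V hV a
      rw [Ultrafilter.eventually_mul]
      refine Filter.Eventually.of_forall fun m => (hV (m⁻¹ * a)).mono fun x hx h => hx ?_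
      rw [← h, inv_mul_cancel_left])
  refine ⟨p.map (·⁻¹), ?_, fun P => ?_⟩
  · exact (Filter.map_mono hp).trans inv_injective.tendsto_cofinite
  · have h := Ultrafilter.eventually_mul p p fun x => P x⁻¹
    rw [hpp] at h
    simpa [Filter.eventually_map, mul_inv_rev] using h

theorem notMem_range_stoneCechUnit_of_tendsto {G : Type*} [TopologicalSpace G] [DiscreteTopology G]
    {l : Filter G} [l.NeBot] (hl : l ≤ Filter.cofinite) {ξ : StoneCech G}
    (hξ : Filter.Tendsto stoneCechUnit l (nhds ξ)) :
    ξ ∉ Set.range (stoneCechUnit : G → StoneCech G) := by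
  classical
  rintro ⟨a, rfl⟩
  have hc : Continuous fun x : G => decide (x = a) := continuous_of_discreteTopology
  have h := (continuous_stoneCechExtend hc).continuousAt.tendsto.comp hξ
  rw [stoneCechExtend_extends, stoneCechExtend_stoneCechUnit, nhds_discrete,
    Filter.tendsto_pure] at h
  obtain ⟨x, hx, hxa⟩ := (h.and (Filter.le_cofinite_iff_eventually_ne.1 hl a)).exists
  exact hxa (by simpa using hx)

theorem tendsto_stoneCechUnit_mul {G : Type} [Group G] [TopologicalSpace G] [DiscreteTopology G]
    {l : Filter G} {ξ : StoneCech G} (hξ : Filter.Tendsto stoneCechUnit l (nhds ξ)) (g : G) :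
    Filter.Tendsto (fun x => stoneCechUnit (x * g)) l (nhds (rightTrans g ξ)) := by
  have hc : Continuous fun x : G => stoneCechUnit (x * g) := continuous_of_discreteTopology
  have h := (continuous_stoneCechExtend hc).continuousAt.tendsto.comp hξ
  rwa [stoneCechExtend_extends] at h

/-- **Existence of non-discrete orbits in `βG`** (Section 5.2 of the paper).
For every countably infinite discrete group `G` there is a point `ξ ∈ βG ∖ G` that lies
in the closure of its punctured orbit `{ξg : g ∈ G, g ≠ e}` under the extended right
action; consequently the orbit map `g ↦ ξg` is not a homeomorphism of the discrete space
`G` onto its image in `βG`. -/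
theorem exists_nonDiscrete_orbit_in_stoneCech
    (G : Type) [Group G] [TopologicalSpace G] [DiscreteTopology G]
    [Countable G] [Infinite G] :
    ∃ ξ : StoneCech G, ξ ∉ Set.range (stoneCechUnit : G → StoneCech G) ∧
      ξ ∈ closure ((fun g : G => rightTrans g ξ) '' {g : G | g ≠ 1}) ∧
      ¬ Topology.IsEmbedding (fun g : G => rightTrans g ξ) := by
  obtain ⟨p, hp, hidem⟩ := exists_nonprincipal_idempotent_ultrafilter G
  obtain ⟨ξ, -, hξ⟩ := isCompact_univ.ultrafilter_le_nhds (p.map (stoneCechUnit : G → StoneCech G))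
    (by simp)
  replace hξ : Filter.Tendsto stoneCechUnit (p : Filter G) (nhds ξ) := hξ
  have hne : ∀ᶠ g in (p : Filter G), g ≠ 1 := Filter.le_cofinite_iff_eventually_ne.1 hp 1
  have horbit : Filter.Tendsto (fun g : G => rightTrans g ξ) p (nhds ξ) := by
    rw [(closed_nhds_basis ξ).tendsto_right_iff]
    rintro C ⟨hC, hCc⟩
    filter_upwards [(hidem fun x => stoneCechUnit x ∈ C).1 (hξ hC)] with g hg
    exact hCc.mem_of_tendsto (tendsto_stoneCechUnit_mul hξ g) hg
  have hone : rightTrans (1 : G) ξ = ξ :=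
    tendsto_nhds_unique (tendsto_stoneCechUnit_mul hξ 1) (by simpa using hξ)
  refine ⟨ξ, notMem_range_stoneCechUnit_of_tendsto hp hξ, ?_, fun h => ?_⟩
  · exact mem_closure_of_tendsto horbit (hne.mono fun g hg => Set.mem_image_of_mem _ hg)
  · have hlim : Filter.Tendsto id (p : Filter G) (nhds 1) :=
      h.isInducing.tendsto_nhds_iff.2 (by rw [hone]; exact horbit)
    rw [nhds_discrete, Filter.tendsto_pure] at hlim
    obtain ⟨g, hg, hg'⟩ := (hlim.and hne).exists
    exact hg' hg

end
end

section
/- Let B be a closed Euclidean ball in ℝⁿ and let X be a countably infinite discrete set. Then the covering dimension of the compact Hausdorff space B × βX equals n. -/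
open Metric Set

noncomputable section

/-! ### A mod 2 Sperner lemma on the cubical grid -/

/-- The mod 2 simplicial coboundary of a function on lists (ordered simplices). -/
def listCoboundary {α : Type*} : List α → (List α → ZMod 2) → ZMod 2
  | [], _ => 0
  | a :: l, F => F l + listCoboundary l fun m => F (a :: m)

/-- The mod 2 sum of `F` over the simplices of the prism between `l.map f` and `l.map g`. -/
def listPrism {α β : Type*} (f g : α → β) : List α → (List β → ZMod 2) → ZMod 2
  | [], _ => 0
  | a :: l, F => F (f a :: g a :: l.map g) + listPrism f g l fun m => F (f a :: m)

/-- The mod 2 sum of `F` over the top-dimensional simplices of a triangulation of the grid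
`{0, …, N} ^ d`, placed in `ℕ → ℕ` by setting the coordinates of index at least `d` to zero. -/
def gridSum (N : ℕ) : ℕ → (List (ℕ → ℕ) → ZMod 2) → ZMod 2
  | 0, F => F [0]
  | d + 1, F => ∑ t ∈ Finset.range N, gridSum N d fun l =>
      listPrism (fun p => Function.update p d t) (fun p => Function.update p d (t + 1)) l F

lemma listCoboundary_add {α : Type*} (l : List α) (F G : List α → ZMod 2) :
    listCoboundary l (fun m => F m + G m) = listCoboundary l F + listCoboundary l G := by
  induction l generalizing F G with
  | nil => simp [listCoboundary]
  | cons a l ih => simp only [listCoboundary, ih]; ring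

lemma listCoboundary_zero {α : Type*} (l : List α) :
    listCoboundary l (fun _ => 0) = 0 := by
  induction l with
  | nil => rfl
  | cons a l ih => simp [listCoboundary, ih]

lemma listCoboundary_map {α β : Type*} (g : α → β) (l : List α) (F : List β → ZMod 2) :
    listCoboundary (l.map g) F = listCoboundary l fun m => F (m.map g) := by
  induction l generalizing F with
  | nil => rfl
  | cons a l ih => simp [listCoboundary, ih]

lemma listPrism_add {α β : Type*} (f g : α → β) (l : List α) (F G : List β → ZMod 2) :
    listPrism f g l (fun m => F m + G m) = listPrism f g l F + listPrism f g l G := by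
  induction l generalizing F G with
  | nil => simp [listPrism]
  | cons a l ih => simp only [listPrism, ih]; ring

lemma gridSum_add (N d : ℕ) (F G : List (ℕ → ℕ) → ZMod 2) :
    gridSum N d (fun m => F m + G m) = gridSum N d F + gridSum N d G := by
  induction d generalizing F G with
  | zero => rfl
  | succ d ih => simp only [gridSum, listPrism_add, ih, Finset.sum_add_distrib]

/-- The prism operator is a mod 2 chain homotopy between the maps induced by `f` and `g`. -/
lemma listPrism_listCoboundary {α β : Type*} (f g : α → β) (l : List α)
    (F : List β → ZMod 2) :
    listPrism f g l (fun m => listCoboundary m F) =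
      F (l.map g) + F (l.map f) + listCoboundary l fun m => listPrism f g m F := by
  induction l generalizing F with
  | nil => simp [listPrism, listCoboundary, CharTwo.add_self_eq_zero]
  | cons a l ih =>
    simp only [listPrism, listCoboundary, listPrism_add, ih, listCoboundary_add,
      listCoboundary_map, List.map_cons]
    linear_combination CharTwo.add_self_eq_zero (F (f a :: l.map g))

lemma exists_of_listPrism_ne_zero {α β : Type*} (f g : α → β) (l : List α)
    (F : List β → ZMod 2) (h : listPrism f g l F ≠ 0) :
    ∃ m, F m ≠ 0 ∧ m.length = l.length + 1 ∧ ∀ q ∈ m, ∃ p ∈ l, q = f p ∨ q = g p := by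
  induction l generalizing F with
  | nil => simp [listPrism] at h
  | cons a l ih =>
    by_cases h0 : F (f a :: g a :: l.map g) = 0
    · obtain ⟨m, h1, h2, h3⟩ := ih (fun m => F (f a :: m)) (by simpa [listPrism, h0] using h)
      refine ⟨f a :: m, h1, by simp [h2], ?_⟩
      intro q hq
      rcases List.mem_cons.1 hq with rfl | hq
      · exact ⟨a, by simp⟩
      · obtain ⟨p, hp, hpq⟩ := h3 q hq
        exact ⟨p, by simp [hp], hpq⟩
    · refine ⟨_, h0, by simp, ?_⟩
      intro q hq
      simp only [List.mem_cons, List.mem_map] at hq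
      rcases hq with rfl | rfl | ⟨p, hp, rfl⟩
      · exact ⟨a, by simp⟩
      · exact ⟨a, by simp⟩
      · exact ⟨p, by simp [hp]⟩

/-- The simplices of the triangulated grid `{0, …, N} ^ d`, relaxed to lists of `d + 1` grid
points that lie in a common unit cube. -/
structure IsGridSimplex (N d : ℕ) (l : List (ℕ → ℕ)) : Prop where
  length_eq : l.length = d + 1
  le : ∀ p ∈ l, ∀ i, p i ≤ N
  eq_zero : ∀ p ∈ l, ∀ i, d ≤ i → p i = 0
  exists_base : ∃ q : ℕ → ℕ, ∀ p ∈ l, ∀ i, q i ≤ p i ∧ p i ≤ q i + 1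

lemma exists_of_gridSum_ne_zero (N d : ℕ) (F : List (ℕ → ℕ) → ZMod 2)
    (h : gridSum N d F ≠ 0) : ∃ l, F l ≠ 0 ∧ IsGridSimplex N d l := by
  induction d generalizing F with
  | zero =>
    exact ⟨_, h, by simp, by simp, by simp, 0, by simp⟩
  | succ d ih =>
    obtain ⟨t, ht, hne⟩ := Finset.exists_ne_zero_of_sum_ne_zero h
    obtain ⟨l, hl, hs⟩ := ih _ hne
    obtain ⟨m, hm, hlen, hmem⟩ := exists_of_listPrism_ne_zero _ _ _ _ hl
    have htN : t < N := Finset.mem_range.1 ht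
    obtain ⟨q, hq⟩ := hs.exists_base
    refine ⟨m, hm, by rw [hlen, hs.length_eq], ?_, ?_, Function.update q d t, ?_⟩
    · intro p hp i
      obtain ⟨p', hp', rfl | rfl⟩ := hmem p hp <;>
      · have := hs.le p' hp' i
        simp only [Function.update_apply]; split_ifs <;> omega
    · intro p hp i hi
      obtain ⟨p', hp', rfl | rfl⟩ := hmem p hp <;>
      · have := hs.eq_zero p' hp' i (by omega)
        simp only [Function.update_apply]; split_ifs <;> omega
    · intro p hp i
      obtain ⟨p', hp', rfl | rfl⟩ := hmem p hp <;>
      · have := hq p' hp' i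
        simp only [Function.update_apply]; split_ifs <;> omega

lemma gridSum_eq_zero (N d : ℕ) (F : List (ℕ → ℕ) → ZMod 2)
    (h : ∀ l, IsGridSimplex N d l → F l = 0) : gridSum N d F = 0 := by
  by_contra hne
  obtain ⟨l, hl, hs⟩ := exists_of_gridSum_ne_zero N d F hne
  exact hl (h l hs)

lemma gridSum_congr (N d : ℕ) (F G : List (ℕ → ℕ) → ZMod 2)
    (h : ∀ l, IsGridSimplex N d l → F l = G l) : gridSum N d F = gridSum N d G := by
  have := gridSum_eq_zero N d (fun l => F l + G l) fun l hl => by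
    rw [h l hl, CharTwo.add_self_eq_zero]
  rwa [gridSum_add, CharTwo.add_eq_zero] at this

lemma gridSum_succ_listCoboundary (N d : ℕ) (F : List (ℕ → ℕ) → ZMod 2) :
    gridSum N (d + 1) (fun l => listCoboundary l F) =
      gridSum N d (fun l => F (l.map fun p => Function.update p d N)) +
      gridSum N d (fun l => F (l.map fun p => Function.update p d 0)) +
      ∑ t ∈ Finset.range N, gridSum N d fun l => listCoboundary l fun m =>
        listPrism (fun p => Function.update p d t) (fun p => Function.update p d (t + 1)) m F := by
  simp only [gridSum, listPrism_listCoboundary, gridSum_add, Finset.sum_add_distrib]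
  congr 1
  have := Finset.sum_range_sub
    (fun t => gridSum N d fun l => F (l.map fun p => Function.update p d t)) N
  simpa only [CharTwo.sub_eq_add, Finset.sum_add_distrib] using this

/-- Stokes' theorem on the grid: coboundaries of functions vanishing on the simplices contained
in a facet of the cube have sum zero. -/
lemma gridSum_listCoboundary_eq_zero (N d : ℕ) (F : List (ℕ → ℕ) → ZMod 2) (hnil : F [] = 0)
    (h : ∀ l, ∀ i < d, ((∀ p ∈ l, p i = 0) ∨ ∀ p ∈ l, p i = N) → F l = 0) :
    gridSum N d (fun l => listCoboundary l F) = 0 := by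
  induction d generalizing F with
  | zero => simpa [gridSum, listCoboundary] using hnil
  | succ d ih =>
    rw [gridSum_succ_listCoboundary, gridSum_eq_zero, gridSum_eq_zero, Finset.sum_eq_zero]
    · simp
    · intro t _
      refine ih _ (by simp [listPrism]) fun l i hi hl => ?_
      by_contra hne
      obtain ⟨m, hm, -, hmem⟩ := exists_of_listPrism_ne_zero _ _ _ _ hne
      refine hm (h m i (by omega) (hl.imp ?_ ?_)) <;>
      · intro hl p hp
        obtain ⟨p', hp', rfl | rfl⟩ := hmem p hp <;> simp [hi.ne, hl p' hp']
    · exact fun l _ => h _ d (by omega) (Or.inl (by simp))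
    · exact fun l _ => h _ d (by omega) (Or.inr (by simp))

/-- The indicator of the lists that are permutations of `0, …, d`. -/
def fullLabels (d : ℕ) (m : List ℕ) : ZMod 2 :=
  if m.Perm (List.range (d + 1)) then 1 else 0

lemma fullLabels_eq_zero {d i : ℕ} (hi : i ≤ d) {m : List ℕ} (h : i ∉ m) :
    fullLabels d m = 0 :=
  if_neg fun hp => h (hp.mem_iff.2 (by simp; omega))

lemma perm_range_of_nodup {d : ℕ} {m : List ℕ} (hn : m.Nodup) (hlen : m.length = d)
    (hlt : ∀ a ∈ m, a < d) : m.Perm (List.range d) :=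
  (List.subperm_of_subset hn fun a ha => List.mem_range.2 (hlt a ha)).perm_of_length_le
    (by simp [hlen])

lemma listCoboundary_perm {α : Type*} {l m : List α} (hlm : l.Perm m) (F : List α → ZMod 2)
    (hF : ∀ a b : List α, a.Perm b → F a = F b) : listCoboundary l F = listCoboundary m F := by
  induction hlm generalizing F with
  | nil => rfl
  | cons x h ih =>
    simp only [listCoboundary]
    rw [hF _ _ h, ih _ fun a b hab => hF _ _ (hab.cons x)]
  | swap x y l =>
    have : (fun m => F (x :: y :: m)) = fun m => F (y :: x :: m) :=
      funext fun m => hF _ _ (List.Perm.swap y x m)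
    simp only [listCoboundary, this]
    ring
  | trans _ _ ih₁ ih₂ => exact (ih₁ F hF).trans (ih₂ F hF)

lemma listCoboundary_fullLabels (d : ℕ) (m : List ℕ) (hlen : m.length = d + 2)
    (hle : ∀ a ∈ m, a ≤ d + 1) :
    listCoboundary m (fullLabels d) = fullLabels (d + 1) m := by
  have hsymm : ∀ a b : List ℕ, a.Perm b → fullLabels d a = fullLabels d b := fun a b h => by
    simp only [fullLabels, h.congr_left]
  by_cases hn : m.Nodup
  · have hm : m.Perm (List.range (d + 2)) :=
      perm_range_of_nodup hn hlen fun a ha => by have := hle a ha; omega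
    have hm' : m.Perm ((d + 1) :: List.range (d + 1)) := by
      rw [List.range_succ] at hm
      exact hm.trans (List.perm_append_singleton _ _)
    have h0 : (fun l => fullLabels d ((d + 1) :: l)) = fun _ => 0 := funext fun l =>
      if_neg fun hp => by simpa using hp.mem_iff.1 (List.mem_cons_self (a := d + 1) (l := l))
    rw [listCoboundary_perm hm' _ hsymm, listCoboundary, h0, listCoboundary_zero]
    simp [fullLabels, hm]
  · obtain ⟨a, ha⟩ := List.exists_duplicate_iff_not_nodup.2 hn
    obtain ⟨l, hl⟩ := (List.duplicate_iff_sublist.1 ha).exists_perm_append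
    have h0 : (fun l => fullLabels d (a :: a :: l)) = fun _ => 0 := funext fun l =>
      if_neg fun hp => by simpa using hp.nodup_iff.2 List.nodup_range
    rw [listCoboundary_perm hl _ hsymm]
    simp only [List.cons_append, List.nil_append, listCoboundary, h0, listCoboundary_zero]
    rw [add_zero, CharTwo.add_self_eq_zero]
    exact (if_neg fun hp => hn (hp.nodup_iff.2 List.nodup_range)).symm

lemma gridSum_fullLabels (N n : ℕ) (ℓ : (ℕ → ℕ) → ℕ)
    (h0 : ∀ p i, p i = 0 → ℓ p ≠ i + 1) (hN : ∀ p, ∀ i < n, p i = N → i + 1 ≤ ℓ p) (d : ℕ) (hd : d ≤ n) :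
    gridSum N d (fun l => fullLabels d (l.map ℓ)) = 1 := by
  have hlabel : ∀ d p, (∀ i, d ≤ i → p i = 0) → ℓ p ≤ d := fun d p hp => by
    by_contra! hlt
    obtain ⟨i, hi⟩ := Nat.exists_eq_succ_of_ne_zero (Nat.ne_zero_of_lt hlt)
    exact h0 p i (hp i (by omega)) hi
  induction d with
  | zero =>
    have : ℓ 0 = 0 := Nat.le_zero.1 (hlabel 0 0 (by simp))
    simp [gridSum, fullLabels, this]
  | succ d ih =>
    have hcob : gridSum N (d + 1) (fun l => fullLabels (d + 1) (l.map ℓ)) =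
        gridSum N (d + 1) fun l => listCoboundary l fun m => fullLabels d (m.map ℓ) := by
      refine gridSum_congr _ _ _ _ fun l hl => ?_
      rw [← listCoboundary_map, listCoboundary_fullLabels _ _ (by simp [hl.length_eq])]
      intro a ha
      obtain ⟨p, hp, rfl⟩ := List.mem_map.1 ha
      exact hlabel _ _ (hl.eq_zero p hp)
    rw [hcob, gridSum_succ_listCoboundary, gridSum_eq_zero, Finset.sum_eq_zero, zero_add,
      add_zero]
    · rw [← ih (by omega)]
      refine gridSum_congr _ _ _ _ fun l hl => ?_
      congr 2
      conv_rhs => rw [← List.map_id l]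
      refine List.map_congr_left fun p hp => ?_
      rw [← hl.eq_zero p hp d le_rfl, Function.update_eq_self, id]
    · intro t _
      refine gridSum_listCoboundary_eq_zero _ _ _ (by simp [listPrism]) fun l i hi hl => ?_
      by_contra hne
      obtain ⟨m, hm, -, hmem⟩ := exists_of_listPrism_ne_zero _ _ _ _ hne
      refine hm ?_
      rcases hl with hl | hl
      · refine fullLabels_eq_zero (i := i + 1) hi fun hmm => ?_
        obtain ⟨p, hp, hpi⟩ := List.mem_map.1 hmm
        refine h0 p i ?_ hpi
        obtain ⟨p', hp', rfl | rfl⟩ := hmem p hp <;> simp [hi.ne, hl p' hp']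
      · refine fullLabels_eq_zero (i := 0) (Nat.zero_le _) fun hmm => ?_
        obtain ⟨p, hp, hpi⟩ := List.mem_map.1 hmm
        have := hN p i (by omega) ?_
        · omega
        obtain ⟨p', hp', rfl | rfl⟩ := hmem p hp <;> simp [hi.ne, hl p' hp']
    · intro l _
      refine fullLabels_eq_zero (i := 0) (Nat.zero_le _) fun hmm => ?_
      simp only [List.map_map, List.mem_map, Function.comp] at hmm
      obtain ⟨p, hp, hpi⟩ := hmm
      have := hN (Function.update p d N) d (by omega) (by simp)
      omega

/-- **Sperner's lemma** for the cubical grid. -/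
lemma exists_isGridSimplex_labels (N n : ℕ) (ℓ : (ℕ → ℕ) → ℕ)
    (h0 : ∀ p i, p i = 0 → ℓ p ≠ i + 1) (hN : ∀ p, ∀ i < n, p i = N → i + 1 ≤ ℓ p) :
    ∃ l, IsGridSimplex N n l ∧ ∀ k ≤ n, ∃ p ∈ l, ℓ p = k := by
  obtain ⟨l, hl, hs⟩ := exists_of_gridSum_ne_zero N n (fun l => fullLabels n (l.map ℓ))
    (by rw [gridSum_fullLabels N n ℓ h0 hN n le_rfl]; exact one_ne_zero)
  refine ⟨l, hs, fun k hk => ?_⟩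
  by_contra! hne
  exact hl (fullLabels_eq_zero hk (by simpa using hne))

/-! ### The lower bound -/

lemma EuclideanSpace.norm_le_card_mul {n : ℕ} (x : EuclideanSpace ℝ (Fin n)) {a : ℝ}
    (ha : 0 ≤ a) (h : ∀ i, |x i| ≤ a) : ‖x‖ ≤ n * a := by
  rw [EuclideanSpace.norm_eq, Real.sqrt_le_iff]
  refine ⟨by positivity, ?_⟩
  calc ∑ i, ‖x i‖ ^ 2 ≤ ∑ _i : Fin n, a ^ 2 :=
        Finset.sum_le_sum fun i _ => pow_le_pow_left₀ (norm_nonneg _) (h i) 2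
    _ = n * a ^ 2 := by simp
    _ ≤ (n * a) ^ 2 := by
      have : (n : ℝ) ≤ (n : ℝ) ^ 2 := by exact_mod_cast Nat.le_self_pow two_ne_zero n
      rw [mul_pow]
      exact mul_le_mul_of_nonneg_right this (sq_nonneg a)

/-- The point with coordinates `c i + s * (p i / N)`. -/
def gridPoint {n : ℕ} (c : EuclideanSpace ℝ (Fin n)) (s : ℝ) (N : ℕ) (p : ℕ → ℕ) :
    EuclideanSpace ℝ (Fin n) :=
  WithLp.toLp 2 fun i => c i + s * ((min (p i) N : ℕ) / N : ℝ)

lemma gridPoint_mem_closedBall {n : ℕ} (c : EuclideanSpace ℝ (Fin n)) {r : ℝ} (hr : 0 < r)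
    (N : ℕ) (p : ℕ → ℕ) : gridPoint c (r / (n + 1)) N p ∈ closedBall c r := by
  rw [mem_closedBall, dist_eq_norm]
  have hs : 0 < r / (n + 1) := by positivity
  refine (EuclideanSpace.norm_le_card_mul _ hs.le fun i => ?_).trans ?_
  · have h1 : ((min (p i) N : ℕ) / N : ℝ) ≤ 1 :=
      div_le_one_of_le₀ (by exact_mod_cast min_le_right _ _) (by positivity)
    have h2 : (0 : ℝ) ≤ ((min (p i) N : ℕ) / N : ℝ) := by positivity
    simp only [gridPoint, PiLp.sub_apply, add_sub_cancel_left]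
    rw [abs_of_nonneg (by positivity)]
    exact mul_le_of_le_one_right hs.le h1
  · rw [mul_div_assoc', div_le_iff₀ (by positivity)]
    nlinarith

lemma dist_gridPoint_le {n : ℕ} (c : EuclideanSpace ℝ (Fin n)) {s : ℝ} (hs : 0 ≤ s)
    (N : ℕ) {p q : ℕ → ℕ} (h : ∀ i, p i ≤ q i + 1 ∧ q i ≤ p i + 1) :
    dist (gridPoint c s N p) (gridPoint c s N q) ≤ n * (s / N) := by
  rw [dist_eq_norm]
  refine EuclideanSpace.norm_le_card_mul _ (by positivity) fun i => ?_
  have h1 : (min (p i) N : ℕ) ≤ min (q i) N + 1 := by have := h i; omega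
  have h2 : (min (q i) N : ℕ) ≤ min (p i) N + 1 := by have := h i; omega
  have h1' : ((min (p i) N : ℕ) : ℝ) ≤ (min (q i) N : ℕ) + 1 := by exact_mod_cast h1
  have h2' : ((min (q i) N : ℕ) : ℝ) ≤ (min (p i) N : ℕ) + 1 := by exact_mod_cast h2
  have : (gridPoint c s N p - gridPoint c s N q) i =
      s / N * (((min (p i) N : ℕ) : ℝ) - (min (q i) N : ℕ)) := by
    simp only [gridPoint, PiLp.sub_apply]; ring
  rw [this, abs_mul, abs_of_nonneg (by positivity : 0 ≤ s / (N : ℝ))]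
  exact mul_le_of_le_one_right (by positivity) (abs_le.2 ⟨by linarith, by linarith⟩)

/-- Lebesgue's covering theorem, for the product of a ball with a nonempty space. -/
lemma le_of_covDimLE_closedBall_prod {n : ℕ} (c : EuclideanSpace ℝ (Fin n)) {r : ℝ}
    (hr : 0 < r) {Y : Type*} [TopologicalSpace Y] [Nonempty Y] {m : ℕ}
    (hm : covDimLE (closedBall c r × Y) m) : n ≤ m := by
  classical
  obtain ⟨y⟩ := ‹Nonempty Y›
  set s : ℝ := r / (n + 1)
  have hs : 0 < s := by positivity
  let u : Finset (Fin n) → Set (closedBall c r × Y) := fun S =>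
    {z | ∀ i, (i ∈ S → c i < z.1.1 i) ∧ (i ∉ S → z.1.1 i < c i + s)}
  have hu : ∀ S, IsOpen (u S) := fun S => by
    simp only [u, Set.ofPred_forall]
    refine isOpen_iInter_of_finite fun i => ?_
    by_cases hi : i ∈ S
    · simp only [hi, forall_true_left, not_true_eq_false, false_imp_iff, and_true]
      exact isOpen_lt continuous_const (by fun_prop)
    · simp only [hi, false_imp_iff, not_false_eq_true, forall_true_left, true_and]
      exact isOpen_lt (by fun_prop) continuous_const
  obtain ⟨W, hWo, hWc, hWu, hWn⟩ := hm (Finset.univ.image u) (by simpa using hu) <|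
    Set.eq_univ_of_forall fun z => by
      refine ⟨u {i | c i < z.1.1 i}, by simp, fun i => ⟨fun hi => ?_, fun hi => ?_⟩⟩
      · simpa using hi
      · have : z.1.1 i ≤ c i := by simpa using hi
        linarith
  have hWS : ∀ w : W, ∃ S, w.1 ⊆ u S := fun w => by simpa using hWu w w.2
  choose S hS using hWS
  obtain ⟨δ, hδ, hball⟩ := lebesgue_number_lemma_of_metric
    (c := fun w : W => {x : closedBall c r | (x, y) ∈ w.1}) isCompact_univ
    (fun w => (hWo w w.2).preimage (by fun_prop)) fun x _ => by
      have : (x, y) ∈ ⋃₀ (W : Set (Set (closedBall c r × Y))) := hWc ▸ Set.mem_univ _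
      obtain ⟨w, hw, hx⟩ := this
      exact Set.mem_iUnion.2 ⟨⟨w, hw⟩, hx⟩
  choose V hV using fun x => hball x (Set.mem_univ x)
  have hVmem : ∀ x, (x, y) ∈ (V x).1 := fun x => hV x (mem_ball_self hδ)
  obtain ⟨N, hN⟩ := exists_nat_gt (n * s / δ)
  have hN0 : (0 : ℝ) < N := lt_of_le_of_lt (by positivity) hN
  let φ : (ℕ → ℕ) → closedBall c r := fun p =>
    ⟨gridPoint c s N p, gridPoint_mem_closedBall c hr N p⟩
  let ℓ : (ℕ → ℕ) → ℕ := fun p => (S (V (φ p))).sup fun i => (i : ℕ) + 1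
  have hφ : ∀ p (i : Fin n), (i ∈ S (V (φ p)) → p i ≠ 0) ∧ (i ∉ S (V (φ p)) → p i ≠ N) := by
    intro p i
    have := hS _ (hVmem (φ p)) i
    refine ⟨fun hi h => ?_, fun hi h => ?_⟩
    · simpa [φ, gridPoint, h] using this.1 hi
    · simpa [φ, gridPoint, h, hN0.ne'] using this.2 hi
  obtain ⟨l, hl, hlab⟩ := exists_isGridSimplex_labels N n ℓ
    (fun p i hp h => by
      have hne : (S (V (φ p))).Nonempty := Finset.nonempty_iff_ne_empty.2 fun he => by
        simp [ℓ, he] at h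
      obtain ⟨j, hj, hji⟩ := Finset.exists_mem_eq_sup _ hne fun i : Fin n => (i : ℕ) + 1
      have : (j : ℕ) = i := by
        have := hji.symm.trans h
        omega
      exact (hφ p j).1 hj (this ▸ hp))
    (fun p i hi hp => by
      have : (⟨i, hi⟩ : Fin n) ∈ S (V (φ p)) := by
        by_contra hni
        exact (hφ p ⟨i, hi⟩).2 hni hp
      exact Finset.le_sup (f := fun i : Fin n => (i : ℕ) + 1) this)
  choose p hpl hpk using fun k : Fin (n + 1) => hlab k (by omega)
  obtain ⟨q, hq⟩ := hl.exists_base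
  have hmem : ∀ k, (φ (p 0), y) ∈ (V (φ (p k))).1 := fun k => by
    refine hV _ (mem_ball.2 ?_)
    refine (dist_gridPoint_le c hs.le N fun i => ?_).trans_lt ?_
    · have h1 := hq _ (hpl 0) i
      have h2 := hq _ (hpl k) i
      omega
    · rw [div_lt_iff₀ hδ] at hN
      rw [mul_div_assoc', div_lt_iff₀ hN0]
      linarith
  have hinj : Function.Injective fun k => (V (φ (p k))).1 := fun j k hjk => by
    have h : V (φ (p j)) = V (φ (p k)) := Subtype.ext hjk
    have : ℓ (p j) = ℓ (p k) := by simp only [ℓ, h]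
    exact Fin.ext (by rw [← hpk j, ← hpk k, this])
  have hfin : {v | v ∈ W ∧ (φ (p 0), y) ∈ v}.Finite := W.finite_toSet.subset fun v hv => hv.1
  have hcard : (Set.range fun k => (V (φ (p k))).1).ncard = n + 1 := by
    rw [← Set.image_univ, Set.ncard_image_of_injective _ hinj, Set.ncard_univ, Nat.card_fin]
  have hsub : (Set.range fun k => (V (φ (p k))).1) ⊆ {v | v ∈ W ∧ (φ (p 0), y) ∈ v} :=
    Set.range_subset_iff.2 fun k => ⟨(V (φ (p k))).2, hmem k⟩
  have := Set.ncard_le_ncard hsub hfin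
  have := hWn (φ (p 0), y)
  omega

/-! ### The upper bound -/

lemma exists_forall_ne_intCast {n : ℕ} (x : Fin n → ℝ) :
    ∃ k : Fin (n + 1), ∀ i, ∀ a : ℤ, x i - k / (n + 1) ≠ a := by
  by_contra! h
  choose i a h using h
  obtain ⟨j, k, hne, hjk⟩ := Fintype.exists_ne_map_eq_of_card_lt i (by simp)
  have hj := h j
  have hk := h k
  rw [hjk] at hj
  have hn : (0 : ℝ) < n + 1 := by positivity
  have h1 : ((k : ℕ) : ℝ) - (j : ℕ) = (a j - a k) * (n + 1) := by
    rw [← hj, ← hk]; field_simp; ring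
  have h2 : ((k : ℕ) : ℤ) - (j : ℕ) = (a j - a k) * (n + 1) := by exact_mod_cast h1
  have h3 : ((k : ℕ) : ℤ) - (j : ℕ) = 0 :=
    Int.eq_zero_of_abs_lt_dvd (m := n + 1) ⟨a j - a k, by rw [h2]; ring⟩
      (abs_lt.2 ⟨by omega, by omega⟩)
  exact hne (Fin.ext (by omega))

/-- The open cube `η • (∏ i, (a i, a i + 1) + t • (1, …, 1))`. -/
def openCube {n : ℕ} (η t : ℝ) (a : Fin n → ℤ) : Set (EuclideanSpace ℝ (Fin n)) :=
  {x | ∀ i, a i < x i / η - t ∧ x i / η - t < a i + 1}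

lemma isOpen_openCube {n : ℕ} (η t : ℝ) (a : Fin n → ℤ) : IsOpen (openCube η t a) := by
  simp only [openCube, Set.ofPred_forall]
  refine isOpen_iInter_of_finite fun i => IsOpen.and ?_ ?_ <;>
  exact isOpen_lt (by fun_prop) (by fun_prop)

lemma eq_of_mem_openCube {n : ℕ} {η t : ℝ} {a b : Fin n → ℤ} {x : EuclideanSpace ℝ (Fin n)}
    (ha : x ∈ openCube η t a) (hb : x ∈ openCube η t b) : a = b := by
  funext i
  rw [← Int.floor_eq_iff.2 ⟨(ha i).1.le, (ha i).2⟩, Int.floor_eq_iff.2 ⟨(hb i).1.le, (hb i).2⟩]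

lemma dist_le_of_mem_openCube {n : ℕ} {η t : ℝ} (hη : 0 < η) {a : Fin n → ℤ}
    {x y : EuclideanSpace ℝ (Fin n)} (hx : x ∈ openCube η t a) (hy : y ∈ openCube η t a) :
    dist x y ≤ n * η := by
  rw [dist_eq_norm]
  refine EuclideanSpace.norm_le_card_mul _ hη.le fun i => ?_
  have h : |(x i - y i) / η| ≤ 1 := by
    rw [sub_div]
    exact abs_le.2 ⟨by linarith [(hx i).1, (hy i).2], by linarith [(hx i).2, (hy i).1]⟩
  rwa [abs_div, abs_of_pos hη, div_le_one hη] at h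

lemma exists_mem_openCube {n : ℕ} (η : ℝ) (x : EuclideanSpace ℝ (Fin n)) :
    ∃ k : Fin (n + 1), ∃ a, x ∈ openCube η (k / (n + 1)) a := by
  obtain ⟨k, hk⟩ := exists_forall_ne_intCast fun i => x i / η
  exact ⟨k, fun i => ⌊x i / η - k / (n + 1)⌋, fun i =>
    ⟨lt_of_le_of_ne (Int.floor_le _) (hk i _).symm, Int.lt_floor_add_one _⟩⟩

open Uniformity in
lemma covDimLE_closedBall_prod {n : ℕ} (c : EuclideanSpace ℝ (Fin n)) (r : ℝ)
    {Y : Type*} [TopologicalSpace Y] [CompactSpace Y] [T2Space Y] [TotallyDisconnectedSpace Y] :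
    covDimLE (closedBall c r × Y) n := by
  classical
  intro U hUo hUc
  let _ : UniformSpace Y := uniformSpaceOfCompactR1
  obtain ⟨E, hE, hEU⟩ := lebesgue_number_lemma (α := closedBall c r × Y) (K := Set.univ)
    (U := fun u : U => u.1) isCompact_univ (fun u => hUo u u.2)
    (hUc.ge.trans Set.sUnion_eq_iUnion.le)
  obtain ⟨D, hD, F, hF, hDF⟩ := entourageProd_subset hE
  obtain ⟨δ, hδ, hδD⟩ := mem_uniformity_dist.1 hD
  have hC : ∀ y : Y, ∃ C, IsClopen C ∧ y ∈ C ∧ C ⊆ UniformSpace.ball y F := fun y => by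
    obtain ⟨O, hO, hOo, hyO⟩ := mem_nhds_iff.1 (UniformSpace.ball_mem_nhds y hF)
    obtain ⟨C, hC, hyC, hCO⟩ := compact_exists_isClopen_in_isOpen hOo hyO
    exact ⟨C, hC, hyC, hCO.trans hO⟩
  choose C hCo hyC hCF using hC
  obtain ⟨T, hT⟩ := isCompact_univ.elim_finite_subcover C (fun y => (hCo y).isOpen)
    fun y _ => Set.mem_iUnion.2 ⟨y, hyC y⟩
  let P : Set T → Set Y := fun A => {y | ∀ t : T, t ∈ A ↔ y ∈ C t}
  have hP : ∀ A, IsOpen (P A) := fun A => by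
    simp only [P, Set.ofPred_forall]
    refine isOpen_iInter_of_finite fun t => ?_
    by_cases ht : t ∈ A
    · simp only [ht, true_iff]
      exact (hCo t).isOpen
    · simp only [ht, false_iff]
      exact (hCo t).compl.isOpen
  let η : ℝ := δ / (n + 1)
  have hη : 0 < η := by positivity
  have hηδ : n * η < δ := by
    simp only [η]
    rw [mul_div_assoc', div_lt_iff₀ (by positivity)]
    nlinarith
  let Q : Fin (n + 1) × (Fin n → ℤ) × Set T → Set (closedBall c r × Y) := fun z =>
    {x | x.1.1 ∈ openCube η (z.1 / (n + 1)) z.2.1 ∧ x.2 ∈ P z.2.2}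
  have hQo : ∀ z, IsOpen (Q z) := fun z =>
    ((isOpen_openCube _ _ _).preimage (by fun_prop)).inter ((hP _).preimage continuous_snd)
  have hQc : ∀ x, ∃ z, x ∈ Q z := fun x => by
    obtain ⟨k, a, hka⟩ := exists_mem_openCube η x.1.1
    exact ⟨⟨k, a, {t | x.2 ∈ C t}⟩, hka, fun t => Iff.rfl⟩
  have hQU : ∀ z, (Q z).Nonempty → ∃ u ∈ U, Q z ⊆ u := by
    rintro z ⟨x, hx, hxP⟩
    obtain ⟨t, ht, hxt⟩ := Set.mem_iUnion₂.1 (hT (Set.mem_univ x.2))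
    obtain ⟨u, hu⟩ := hEU (x.1, t) (Set.mem_univ _)
    refine ⟨u, u.2, fun x' hx' => hu (hDF ⟨hδD ?_, hCF t ?_⟩)⟩
    · exact (dist_le_of_mem_openCube hη hx hx'.1).trans_lt hηδ
    · exact (hx'.2 ⟨t, ht⟩).1 ((hxP ⟨t, ht⟩).2 hxt)
  obtain ⟨Z, hZ⟩ := isCompact_univ.elim_finite_subcover Q hQo
    fun x _ => Set.mem_iUnion.2 (hQc x)
  refine ⟨(Z.image Q).filter Set.Nonempty, ?_, ?_, ?_, fun x => ?_⟩
  · intro v hv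
    obtain ⟨z, -, rfl⟩ := Finset.mem_image.1 (Finset.mem_filter.1 hv).1
    exact hQo z
  · refine Set.eq_univ_of_forall fun x => ?_
    obtain ⟨z, hz, hx⟩ := Set.mem_iUnion₂.1 (hZ (Set.mem_univ x))
    exact ⟨Q z, Finset.mem_coe.2 <|
      Finset.mem_filter.2 ⟨Finset.mem_image_of_mem _ hz, ⟨x, hx⟩⟩, hx⟩
  · intro v hv
    obtain ⟨hv, hne⟩ := Finset.mem_filter.1 hv
    obtain ⟨z, -, rfl⟩ := Finset.mem_image.1 hv
    exact hQU z hne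
  · have hsub : {v | v ∈ (Z.image Q).filter Set.Nonempty ∧ x ∈ v} ⊆
        Set.range fun k : Fin (n + 1) => {x' : closedBall c r × Y |
          ∃ a A, x ∈ Q (k, a, A) ∧ x' ∈ Q (k, a, A)} := by
      rintro v ⟨hv, hx⟩
      obtain ⟨⟨k, a, A⟩, -, rfl⟩ := Finset.mem_image.1 (Finset.mem_filter.1 hv).1
      refine ⟨k, Set.Subset.antisymm ?_ fun x' hx' => ⟨a, A, hx, hx'⟩⟩
      rintro x' ⟨b, B, hxB, hx'⟩
      have hab : b = a := eq_of_mem_openCube hxB.1 hx.1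
      have hAB : B = A := Set.ext fun t => (hxB.2 t).trans (hx.2 t).symm
      rwa [hab, hAB] at hx'
    refine (Set.ncard_le_ncard hsub (Set.finite_range _)).trans ?_
    rw [← Set.image_univ]
    refine (Set.ncard_image_le Set.finite_univ).trans ?_
    rw [Set.ncard_univ, Nat.card_fin]

/-- **Dimension of `B × βX`** (part of the proof of Proposition 2.2 of the paper).
Let `B` be a closed Euclidean ball in `ℝⁿ` and let `X` be a countably infinite discrete
set. Then the covering dimension of the compact Hausdorff space `B × βX` equals `n`. -/
theorem covDim_closedBall_prod_stoneCech {n : ℕ}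
    (c : EuclideanSpace ℝ (Fin n)) (r : ℝ) (hr : 0 < r)
    (X : Type) [TopologicalSpace X] [DiscreteTopology X] [Countable X] [Infinite X] :
    covDimEq (↥(Metric.closedBall c r) × StoneCech X) n := by
  have : ExtremallyDisconnected (StoneCech X) :=
    CompactT2.Projective.extremallyDisconnected StoneCech.projective
  have : Nonempty (StoneCech X) := (Infinite.nonempty X).map stoneCechUnit
  exact ⟨covDimLE_closedBall_prod c r, fun m => le_of_covDimLE_closedBall_prod c hr⟩

end
end
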